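/- arXiv:1904.09070 — 2 statements merged into one kernel-verified Lean document; each statement's English description precedes it below -/
import Mathlib

section
/- ∫₀^∞ sin(π x)/(exp(2π√x) − 1) dx = (π√2 − 4)/(8π). -/
open Real MeasureTheory

noncomputable section

def psiF (z : ℂ) : ℂ := dslope (fun z : ℂ => Complex.exp (2 * π * z)) 0 z
def phiF (z : ℂ) : ℂ := (psiF z)⁻¹
def kapF (z : ℂ) : ℂ := dslope phiF 0 z + 1 / 2

lemma psiF_diff : Differentiable ℂ psiF := by
  have h : DifferentiableOn ℂ (fun z : ℂ => Complex.exp (2 * π * z)) Set.univ := by fun_prop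
  have := (Complex.differentiableOn_dslope (c := 0) Filter.univ_mem).2 h
  exact differentiableOn_univ.1 this

lemma psiF_zero : psiF 0 = 2 * π := by
  unfold psiF
  rw [dslope_same]
  have : HasDerivAt (fun z : ℂ => Complex.exp (2 * π * z)) (Complex.exp (2 * π * 0) * (2 * π * 1)) 0 :=
    ((hasDerivAt_id (0:ℂ)).const_mul (2 * π : ℂ)).cexp
  rw [this.deriv]; simp

lemma psiF_ne {z : ℂ} (hz : z ≠ 0) : psiF z = (Complex.exp (2 * π * z) - 1) / z := by
  unfold psiF
  rw [dslope_of_ne _ hz, slope_def_field]; simp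

lemma phiF_ne {z : ℂ} (hz : z ≠ 0) : phiF z = z / (Complex.exp (2 * π * z) - 1) := by
  rw [phiF, psiF_ne hz, inv_div]

lemma phiF_zero : phiF 0 = 1 / (2 * π) := by
  rw [phiF, psiF_zero, one_div]

lemma kapF_ne {z : ℂ} (hz : z ≠ 0) :
    kapF z = 1 / (Complex.exp (2 * π * z) - 1) - 1 / (2 * π * z) + 1 / 2 := by
  rw [kapF, dslope_of_ne _ hz, slope_def_field, phiF_ne hz, phiF_zero, sub_zero, sub_div]
  congr 2
  · field_simp
  · field_simp

lemma phiF_eq (z : ℂ) : phiF z = 1 / (2 * π) - z / 2 + z * kapF z := by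
  have := sub_smul_dslope phiF 0 z
  simp only [sub_zero, smul_eq_mul] at this
  rw [kapF, mul_add, this, phiF_zero]; ring

lemma exp_ne_one {z : ℂ} (hz : z ≠ 0) (h : |z.im| < 1 ∨ z.re ≠ 0) : Complex.exp (2 * π * z) ≠ 1 := by
  intro h1
  obtain ⟨n, hn⟩ := Complex.exp_eq_one_iff.1 h1
  have hz' : z = n * Complex.I := by
    have : (2 * π : ℂ) ≠ 0 := by simp [Real.pi_ne_zero]
    apply mul_left_cancel₀ this; rw [hn]; ring
  have hre : z.re = 0 := by rw [hz']; simp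
  have him : z.im = n := by rw [hz']; simp
  rcases h with h | h
  · rw [him] at h
    have : n = 0 := by
      have h2 : |n| < 1 := by exact_mod_cast h
      exact Int.abs_lt_one_iff.1 h2
    apply hz; rw [hz', this]; simp
  · exact h hre

lemma psiF_ne_zero {z : ℂ} (h : |z.im| < 1 ∨ z.re ≠ 0) : psiF z ≠ 0 := by
  by_cases hz : z = 0
  · rw [hz, psiF_zero]; simp [Real.pi_ne_zero]
  · rw [psiF_ne hz]
    exact div_ne_zero (sub_ne_zero.2 (exp_ne_one hz h)) hz

lemma phiF_diff {z : ℂ} (h : |z.im| < 1 ∨ z.re ≠ 0) : DifferentiableAt ℂ phiF z :=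
  (psiF_diff z).inv (psiF_ne_zero h)

lemma kapF_diff {z : ℂ} (h : |z.im| < 1 ∨ z.re ≠ 0) : DifferentiableAt ℂ kapF z := by
  have ho : IsOpen {z : ℂ | psiF z ≠ 0} := isOpen_ne_fun psiF_diff.continuous continuous_const
  have h0 : {z : ℂ | psiF z ≠ 0} ∈ nhds (0:ℂ) := ho.mem_nhds (psiF_ne_zero (by simp))
  have hp : DifferentiableOn ℂ phiF {z : ℂ | psiF z ≠ 0} := fun w hw =>
    ((psiF_diff w).inv hw).differentiableWithinAt
  have := ((Complex.differentiableOn_dslope h0).2 hp).differentiableAt (ho.mem_nhds (psiF_ne_zero h))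
  exact this.add_const _

lemma kapF_neg (z : ℂ) (h : |z.im| < 1 ∨ z.re ≠ 0) (hz : z ≠ 0) : kapF (-z) = - kapF z := by
  rw [kapF_ne hz, kapF_ne (neg_ne_zero.2 hz)]
  have h1 := sub_ne_zero.2 (exp_ne_one hz h)
  have h2 : Complex.exp (2 * π * -z) = (Complex.exp (2 * π * z))⁻¹ := by
    rw [← Complex.exp_neg]; congr 1; ring
  have h3 := Complex.exp_ne_zero (2 * π * z)
  rw [h2]
  generalize Complex.exp (2 * π * z) = w at *
  have h4 : (w⁻¹ - 1) = -(w - 1) / w := by field_simp; ring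
  rw [h4]
  have hpi : (π : ℂ) ≠ 0 := by simp [Real.pi_ne_zero]
  field_simp
  ring

lemma kapF_bound_far {z : ℂ} (h : 3 / 4 ≤ |z.re|) : ‖kapF z‖ ≤ 4 := by
  have hz : z ≠ 0 := by rintro rfl; norm_num at h
  have hn : 3 / 4 ≤ ‖z‖ := h.trans (Complex.abs_re_le_norm z)
  have hw : ‖Complex.exp (2 * π * z)‖ = Real.exp (2 * π * z.re) := by
    rw [Complex.norm_exp]; simp
  have hpi := Real.pi_gt_three
  have h1 : 1 / 2 ≤ ‖Complex.exp (2 * π * z) - 1‖ := by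
    rcases le_abs.1 h with h | h
    · have := norm_sub_norm_le (Complex.exp (2 * π * z)) 1
      rw [hw, norm_one] at this
      have := Real.add_one_le_exp (2 * π * z.re)
      nlinarith
    · have := norm_sub_norm_le 1 (Complex.exp (2 * π * z))
      rw [norm_sub_rev, hw, norm_one] at this
      have h3 := Real.add_one_le_exp (-(2 * π * z.re))
      have h5 : 2 ≤ Real.exp (-(2 * π * z.re)) := by nlinarith
      have h4 : Real.exp (2 * π * z.re) ≤ 1 / 2 := by
        rw [Real.exp_neg] at h5
        rw [le_div_iff₀ two_pos]
        have := mul_le_mul_of_nonneg_left h5 (Real.exp_pos (2 * π * z.re)).le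
        rwa [mul_inv_cancel₀ (Real.exp_pos _).ne'] at this
      linarith
  rw [kapF_ne hz]
  have e1 : ‖1 / (Complex.exp (2 * π * z) - 1)‖ ≤ 2 := by
    rw [norm_div, norm_one, div_le_iff₀ (by linarith)]; linarith
  have e2 : ‖1 / (2 * π * z)‖ ≤ 1 := by
    rw [norm_div, norm_one, norm_mul, norm_mul, Complex.norm_real, Real.norm_eq_abs, abs_of_pos Real.pi_pos]
    rw [Complex.norm_ofNat]
    rw [div_le_iff₀ (by nlinarith)]; nlinarith
  have e3 : ‖(1 / 2 : ℂ)‖ ≤ 1 := by norm_num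
  calc _ ≤ ‖1 / (Complex.exp (2 * π * z) - 1) - 1 / (2 * π * z)‖ + ‖(1 / 2 : ℂ)‖ := norm_add_le _ _
    _ ≤ ‖1 / (Complex.exp (2 * π * z) - 1)‖ + ‖1 / (2 * π * z)‖ + ‖(1 / 2 : ℂ)‖ := by
      gcongr; exact norm_sub_le _ _
    _ ≤ _ := by linarith

/-- the slanted multiplier -/
def aa : ℂ := 1 + Complex.I

lemma strip_ok {ζ : ℂ} (h0 : 0 ≤ ζ.im) (h1 : ζ.im ≤ 1 / 4) : |(aa * ζ).im| < 1 ∨ (aa * ζ).re ≠ 0 := by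
  by_cases h : (aa * ζ).re = 0
  · left
    simp [aa] at h ⊢
    rw [abs_lt]; constructor <;> linarith
  · right; exact h

lemma kapF_bound : ∃ C : ℝ, 0 ≤ C ∧ ∀ ζ : ℂ, 0 ≤ ζ.im → ζ.im ≤ 1 / 4 → ‖kapF (aa * ζ)‖ ≤ C := by
  have hK : IsCompact (Set.Icc (-1:ℝ) 1 ×ℂ Set.Icc (0:ℝ) (1/4)) := isCompact_Icc.reProdIm isCompact_Icc
  have hc : ContinuousOn (fun ζ => kapF (aa * ζ)) (Set.Icc (-1:ℝ) 1 ×ℂ Set.Icc (0:ℝ) (1/4)) := by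
    intro ζ hζ
    have hζ2 := hζ.2
    have := (kapF_diff (strip_ok hζ2.1 hζ2.2)).continuousAt
    exact (ContinuousAt.comp (f := fun ζ => aa * ζ) (x := ζ) this (by fun_prop)).continuousWithinAt
  obtain ⟨C, hC⟩ := hK.exists_bound_of_continuousOn hc
  refine ⟨max C 4, by simp, fun ζ h0 h1 => ?_⟩
  by_cases h : |ζ.re| ≤ 1
  · exact (hC ζ ⟨abs_le.1 h, h0, h1⟩).trans (le_max_left _ _)
  · refine (kapF_bound_far ?_).trans (le_max_right _ _)
    push Not at h
    have : (aa * ζ).re = ζ.re - ζ.im := by simp [aa]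
    rw [this]
    rcases lt_abs.1 h with h | h
    · exact le_abs.2 (Or.inl (by linarith))
    · exact le_abs.2 (Or.inr (by linarith))

def ee (ζ : ℂ) : ℂ := Complex.exp (-(2 * π) * ζ ^ 2)

structure Good (g : ℂ → ℂ) : Prop where
  diff : ∀ ζ : ℂ, 0 ≤ ζ.im → ζ.im ≤ 1 / 4 → DifferentiableAt ℂ g ζ
  bd : ∃ C : ℝ, 0 ≤ C ∧ ∀ ζ : ℂ, 0 ≤ ζ.im → ζ.im ≤ 1 / 4 → ‖g ζ‖ ≤ C * (1 + ‖ζ‖)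

lemma ee_norm (r s : ℝ) : ‖ee (r + s * Complex.I)‖ = Real.exp (2 * π * s ^ 2) * Real.exp (-(2 * π) * r ^ 2) := by
  rw [ee, Complex.norm_exp, ← Real.exp_add]
  congr 1
  simp [pow_two]; ring

lemma ee_diff : Differentiable ℂ ee := by unfold ee; fun_prop

lemma Good.est {g : ℂ → ℂ} (hg : Good g) : ∃ C : ℝ, 0 ≤ C ∧ ∀ r s : ℝ, 0 ≤ s → s ≤ 1 / 4 →
    ‖g (r + s * Complex.I) * ee (r + s * Complex.I)‖ ≤ C * ((2 + |r|) * Real.exp (-(2 * π) * r ^ 2)) := by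
  obtain ⟨C, hC, h⟩ := hg.bd
  refine ⟨C * Real.exp (2 * π), by positivity, fun r s h0 h1 => ?_⟩
  rw [norm_mul, ee_norm]
  have e1 := h (r + s * Complex.I) (by simpa) (by simpa using h1)
  have e2 : ‖(r + s * Complex.I : ℂ)‖ ≤ |r| + 1 := by
    refine (norm_add_le _ _).trans ?_
    simp [abs_of_nonneg h0]; linarith
  have e3 : Real.exp (2 * π * s ^ 2) ≤ Real.exp (2 * π) := by
    apply Real.exp_le_exp.2
    have : s ^ 2 ≤ 1 := by nlinarith
    nlinarith [Real.pi_pos]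
  calc _ ≤ (C * (1 + ‖(r + s * Complex.I : ℂ)‖)) * (Real.exp (2 * π) * Real.exp (-(2 * π) * r ^ 2)) := by gcongr
    _ ≤ (C * (1 + (|r| + 1))) * (Real.exp (2 * π) * Real.exp (-(2 * π) * r ^ 2)) := by gcongr
    _ = _ := by ring

lemma dom_int : Integrable (fun r : ℝ => (2 + |r|) * Real.exp (-(2 * π) * r ^ 2)) := by
  have h2 : 0 < 2 * π := by positivity
  have i1 := (integrable_exp_neg_mul_sq h2).const_mul 2
  have i2 := (integrable_mul_exp_neg_mul_sq h2).norm
  refine (i1.add i2).congr (Filter.Eventually.of_forall fun r => ?_)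
  simp; ring

lemma Good.int {g : ℂ → ℂ} (hg : Good g) {s : ℝ} (h0 : 0 ≤ s) (h1 : s ≤ 1 / 4) :
    Integrable (fun r : ℝ => g (r + s * Complex.I) * ee (r + s * Complex.I)) := by
  obtain ⟨C, hC, h⟩ := hg.est
  refine (dom_int.const_mul C).mono' ?_ (Filter.Eventually.of_forall fun r => h r s h0 h1)
  apply Continuous.aestronglyMeasurable
  rw [continuous_iff_continuousAt]
  intro r
  have : ContinuousAt (fun ζ => g ζ * ee ζ) (r + s * Complex.I) :=
    ((hg.diff _ (by simpa) (by simpa using h1)).mul (ee_diff _)).continuousAt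
  exact ContinuousAt.comp (f := fun r : ℝ => (r + s * Complex.I : ℂ)) (x := r) this (by fun_prop)

lemma dom_lim : Filter.Tendsto (fun r : ℝ => (2 + |r|) * Real.exp (-(2 * π) * r ^ 2)) Filter.atTop (nhds 0) := by
  have h1 := Real.tendsto_pow_mul_exp_neg_atTop_nhds_zero 1
  have h0 := Real.tendsto_pow_mul_exp_neg_atTop_nhds_zero 0
  have := (h0.const_mul 2).add h1
  simp only [pow_zero, one_mul, pow_one, mul_zero, add_zero] at this
  refine squeeze_zero' (Filter.Eventually.of_forall fun r => by positivity) ?_ this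
  filter_upwards [Filter.eventually_ge_atTop 1] with r hr
  rw [abs_of_nonneg (by linarith), ← add_mul]
  gcongr
  nlinarith [Real.pi_gt_three]

lemma Good.shift {g : ℂ → ℂ} (hg : Good g) :
    ∫ r : ℝ, g r * ee r = ∫ r : ℝ, g (r + (1/4 : ℝ) * Complex.I) * ee (r + (1/4 : ℝ) * Complex.I) := by
  obtain ⟨C, hC, h⟩ := hg.est
  have i0 := hg.int le_rfl (by norm_num)
  have i1 := hg.int (s := 1/4) (by norm_num) le_rfl
  have t0 := intervalIntegral_tendsto_integral i0 Filter.tendsto_neg_atTop_atBot Filter.tendsto_id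
  have t1 := intervalIntegral_tendsto_integral i1 Filter.tendsto_neg_atTop_atBot Filter.tendsto_id
  have hs : Filter.Tendsto (fun R : ℝ => 
     ((∫ x : ℝ in (-R)..R, g (x + (0:ℝ) * Complex.I) * ee (x + (0:ℝ) * Complex.I)) -
      (∫ x : ℝ in (-R)..R, g (x + (1/4:ℝ) * Complex.I) * ee (x + (1/4:ℝ) * Complex.I)))) Filter.atTop (nhds 0) := by
    have hd := dom_lim.const_mul (2 * C)
    rw [mul_zero] at hd
    refine squeeze_zero_norm (fun R => ?_) hd
    have := Complex.integral_boundary_rect_eq_zero_of_differentiableOn (fun ζ => g ζ * ee ζ) 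
      (⟨-R, 0⟩) (⟨R, 1/4⟩) ?_
    · simp only [smul_eq_mul] at this
      set A := ∫ x : ℝ in (-R)..R, g (x + (0:ℝ) * Complex.I) * ee (x + (0:ℝ) * Complex.I)
      set B := ∫ x : ℝ in (-R)..R, g (x + (1/4:ℝ) * Complex.I) * ee (x + (1/4:ℝ) * Complex.I)
      have key : ∀ r : ℝ, |r| = |R| → ‖∫ y : ℝ in (0:ℝ)..(1/4:ℝ), g (r + y * Complex.I) * ee (r + y * Complex.I)‖ ≤
          C * ((2 + |R|) * Real.exp (-(2 * π) * R ^ 2)) := by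
        intro r hr
        have := intervalIntegral.norm_integral_le_of_norm_le_const (a := (0:ℝ)) (b := 1/4) 
          (f := fun y : ℝ => g (r + y * Complex.I) * ee (r + y * Complex.I)) 
          (C := C * ((2 + |R|) * Real.exp (-(2 * π) * R ^ 2))) ?_
        · refine this.trans ?_
          have : 0 ≤ C * ((2 + |R|) * Real.exp (-(2 * π) * R ^ 2)) := by positivity
          rw [sub_zero, abs_of_pos (show (0:ℝ) < 1 / 4 by norm_num)]; linarith
        · intro y hy
          rw [Set.uIoc_of_le (by norm_num)] at hy
          have := h r y hy.1.le hy.2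
          rwa [hr, ← sq_abs r, hr, sq_abs] at this
      have k1 := key R rfl
      have k2 := key (-R) (abs_neg R)
      have : A - B = Complex.I * (∫ y : ℝ in (0:ℝ)..(1/4:ℝ), g ((-R : ℝ) + y * Complex.I) * ee ((-R : ℝ) + y * Complex.I)) - 
         Complex.I * (∫ y : ℝ in (0:ℝ)..(1/4:ℝ), g (R + y * Complex.I) * ee (R + y * Complex.I)) := by
        linear_combination this
      rw [this]
      refine (norm_sub_le _ _).trans ?_
      rw [norm_mul, norm_mul, Complex.norm_I, one_mul, one_mul]
      linarith
    · intro ζ hζ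
      have := hζ.2
      simp only [Set.mem_preimage] at this
      rw [Set.uIcc_of_le (by norm_num)] at this
      exact ((hg.diff ζ this.1 this.2).mul (ee_diff _)).differentiableWithinAt
  have := tendsto_nhds_unique (t0.sub t1) hs
  simpa [sub_eq_zero] using this

lemma aa_ne : aa ≠ 0 := by
  intro h; have := congrArg Complex.re h; simp [aa] at this

lemma aa_sq : aa ^ 2 = 2 * Complex.I := by
  rw [aa]; ring_nf; simp

lemma ee_refl (ζ : ℂ) : ee (aa / 2 - ζ) = - (Complex.exp (2 * π * (aa * ζ)) * ee ζ) := by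
  unfold ee
  have hneg : ∀ x : ℂ, -Complex.exp x = Complex.exp (π * Complex.I + x) := by
    intro x; rw [Complex.exp_add, Complex.exp_pi_mul_I, neg_one_mul]
  rw [← Complex.exp_add, hneg]
  rw [Complex.exp_eq_exp_iff_exists_int]
  refine ⟨-1, ?_⟩
  push_cast
  linear_combination (-(π : ℂ) / 2) * aa_sq

lemma exp_refl (ζ : ℂ) : Complex.exp (2 * π * (aa * (aa / 2 - ζ))) = (Complex.exp (2 * π * (aa * ζ)))⁻¹ := by
  rw [← Complex.exp_neg]
  rw [Complex.exp_eq_exp_iff_exists_int]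
  refine ⟨1, ?_⟩
  push_cast
  linear_combination (π : ℂ) * aa_sq

def GG (ζ : ℂ) : ℂ := phiF (aa * ζ) / aa
def KK (ζ : ℂ) : ℂ := kapF (aa * ζ)
def HH (ζ : ℂ) : ℂ := aa / 2 - ζ + aa / 2 * (KK ζ - 1 / 2)

lemma pointwise {ζ : ℂ} (h : ζ.im = 1 / 4) :
    GG (aa / 2 - ζ) * ee (aa / 2 - ζ) + GG ζ * ee ζ =
    -((aa / 2 - ζ) * ee (aa / 2 - ζ)) + HH ζ * ee ζ + (1 / (4 * π)) * (1 / ζ * ee ζ) := by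
  have hz : ζ ≠ 0 := by rintro rfl; norm_num at h
  have hz2 : aa / 2 - ζ ≠ 0 := by
    intro h2
    have := congrArg Complex.im h2
    simp [aa, h] at this; norm_num at this
  have ha := aa_ne
  have hw := sub_ne_zero.2 (exp_ne_one (mul_ne_zero ha hz) (strip_ok (ζ := ζ) (by linarith) (by linarith)))
  have hw0 := Complex.exp_ne_zero (2 * π * (aa * ζ))
  rw [HH, KK, GG, GG, phiF_ne (mul_ne_zero ha hz), phiF_ne (mul_ne_zero ha hz2), kapF_ne (mul_ne_zero ha hz),
    exp_refl, ee_refl]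
  generalize Complex.exp (2 * π * (aa * ζ)) = w at *
  have h4 : (w⁻¹ - 1) = -(w - 1) / w := by field_simp; ring
  rw [h4]
  have hpi : (π : ℂ) ≠ 0 := by simp [Real.pi_ne_zero]
  generalize ee ζ = E
  generalize aa = a at *
  generalize (π : ℂ) = p at *
  field_simp
  ring

lemma KK_diff {ζ : ℂ} (h0 : 0 ≤ ζ.im) (h1 : ζ.im ≤ 1 / 4) : DifferentiableAt ℂ KK ζ :=
  DifferentiableAt.comp (f := fun ζ => aa * ζ) ζ (kapF_diff (strip_ok h0 h1)) (by fun_prop)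

lemma good_KK : Good KK := by
  obtain ⟨C, hC, h⟩ := kapF_bound
  refine ⟨fun ζ h0 h1 => KK_diff h0 h1, C, hC, fun ζ h0 h1 => (h ζ h0 h1).trans ?_⟩
  nlinarith [norm_nonneg ζ, mul_nonneg hC (norm_nonneg ζ)]

lemma good_id : Good (fun ζ => ζ) :=
  ⟨fun ζ _ _ => by fun_prop, 1, zero_le_one, fun ζ _ _ => by linarith⟩

lemma good_const (c : ℂ) : Good (fun _ => c) :=
  ⟨fun ζ _ _ => by fun_prop, ‖c‖, norm_nonneg c, fun ζ _ _ => by nlinarith [norm_nonneg ζ, norm_nonneg c, mul_nonneg (norm_nonneg c) (norm_nonneg ζ)]⟩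

lemma Good.add {f g : ℂ → ℂ} (hf : Good f) (hg : Good g) : Good (fun ζ => f ζ + g ζ) := by
  obtain ⟨C, hC, h⟩ := hf.bd
  obtain ⟨D, hD, k⟩ := hg.bd
  refine ⟨fun ζ h0 h1 => (hf.diff ζ h0 h1).add (hg.diff ζ h0 h1), C + D, by positivity, fun ζ h0 h1 => ?_⟩
  refine (norm_add_le _ _).trans ?_
  rw [add_mul]; exact add_le_add (h ζ h0 h1) (k ζ h0 h1)

lemma Good.smul {f : ℂ → ℂ} (hf : Good f) (c : ℂ) : Good (fun ζ => c * f ζ) := by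
  obtain ⟨C, hC, h⟩ := hf.bd
  refine ⟨fun ζ h0 h1 => (hf.diff ζ h0 h1).const_mul c, ‖c‖ * C, by positivity, fun ζ h0 h1 => ?_⟩
  rw [norm_mul, mul_assoc]; gcongr; exact h ζ h0 h1

lemma good_idKK : Good (fun ζ => ζ * KK ζ) := by
  obtain ⟨C, hC, h⟩ := kapF_bound
  refine ⟨fun ζ h0 h1 => differentiableAt_id.mul (KK_diff h0 h1), C, hC, fun ζ h0 h1 => ?_⟩
  have := h ζ h0 h1
  rw [norm_mul, KK]
  nlinarith [norm_nonneg ζ, mul_le_mul_of_nonneg_left this (norm_nonneg ζ)]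

lemma good_GG : Good GG := by
  have h := ((good_const (1 / (2 * π) / aa)).add (good_id.smul (-1/2))).add good_idKK
  convert h using 1
  funext ζ
  have ha := aa_ne
  rw [GG, phiF_eq, KK]
  field_simp
  ring

lemma good_HH : Good HH := by
  have h := ((good_const (aa / 4)).add (good_id.smul (-1))).add (good_KK.smul (aa / 2))
  convert h using 1
  funext ζ
  rw [HH]
  ring

lemma ee_neg (ζ : ℂ) : ee (-ζ) = ee ζ := by unfold ee; rw [neg_sq]

lemma odd_int (f : ℝ → ℂ) (h : ∀ᵐ r : ℝ, f (-r) = - f r) : ∫ r : ℝ, f r = 0 := by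
  have h1 := integral_neg_eq_self f volume
  rw [integral_congr_ae h, integral_neg] at h1
  have h2 : (2:ℂ) * ∫ r : ℝ, f r = 0 := by linear_combination -h1
  simpa using h2

lemma int_id : ∫ r : ℝ, (r : ℂ) * ee r = 0 :=
  odd_int _ (Filter.Eventually.of_forall fun r => by simp [ee_neg])

lemma ae_ne : ∀ᵐ r : ℝ, r ≠ 0 := by
  simp [ae_iff]

lemma int_KK : ∫ r : ℝ, KK r * ee r = 0 := by
  refine odd_int _ ?_
  filter_upwards [ae_ne] with r hr
  have hr' : (r : ℂ) ≠ 0 := by exact_mod_cast hr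
  have := kapF_neg (aa * r) (strip_ok (by simp) (by simp)) (mul_ne_zero aa_ne hr')
  simp only [Complex.ofReal_neg, ee_neg, KK, mul_neg, this, neg_mul]

lemma ee_real (r : ℝ) : ee r = ((Real.exp (-(2 * π) * r ^ 2) : ℝ) : ℂ) := by
  unfold ee; push_cast; rfl

lemma int_one : ∫ r : ℝ, ee r = ((√2 / 2 : ℝ) : ℂ) := by
  simp_rw [ee_real]
  rw [integral_complex_ofReal, integral_gaussian]
  congr 1
  rw [show π / (2 * π) = 2 / 2 ^ 2 by field_simp, Real.sqrt_div (by norm_num), Real.sqrt_sq (by norm_num)]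

lemma real_int {g : ℂ → ℂ} (hg : Good g) : Integrable (fun r : ℝ => g r * ee r) := by
  simpa using hg.int le_rfl (by norm_num)

lemma int_HH : ∫ r : ℝ, HH r * ee r = aa / 4 * ((√2 / 2 : ℝ) : ℂ) := by
  have e : ∀ r : ℝ, HH r * ee r = (aa / 4 * ee r + (-1) * (r * ee r)) + aa / 2 * (KK r * ee r) := by
    intro r; rw [HH]; ring
  simp_rw [e]
  have i1 : Integrable (fun r : ℝ => aa / 4 * ee r) := real_int (good_const (aa/4))
  have i2 : Integrable (fun r : ℝ => (-1 : ℂ) * (r * ee r)) := (real_int good_id).const_mul _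
  have i3 : Integrable (fun r : ℝ => aa / 2 * (KK r * ee r)) := (real_int good_KK).const_mul _
  rw [integral_add (f := fun r : ℝ => aa / 4 * ee r + (-1) * (r * ee r)) (i1.add i2) i3, integral_add i1 i2, integral_const_mul, integral_const_mul, integral_const_mul,
    int_id, int_KK, int_one]
  ring

/-- point on the shifted line -/
def ln (r : ℝ) : ℂ := r + (1/4 : ℝ) * Complex.I

lemma ln_im (r : ℝ) : (ln r).im = 1 / 4 := by simp [ln]

lemma ln_refl (r : ℝ) : ln (1 / 2 - r) = aa / 2 - ln r := by
  simp only [ln, aa]; push_cast; ring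

lemma X_re : (∫ r : ℝ, 1 / ln r * ee (ln r)).re = 0 := by
  set X := ∫ r : ℝ, 1 / ln r * ee (ln r) with hX
  have h1 : (starRingEnd ℂ) X = - X := by
    rw [hX, ← integral_conj, ← integral_neg, ← integral_neg_eq_self]
    refine integral_congr_ae (Filter.Eventually.of_forall fun r => ?_)
    have e : (starRingEnd ℂ) (ln (-r)) = - ln r := by apply Complex.ext <;> simp [ln]
    have e2 : ∀ z, (starRingEnd ℂ) (ee z) = ee ((starRingEnd ℂ) z) := by
      intro z; unfold ee; rw [← Complex.exp_conj]
      rw [show (-(2 * π) : ℂ) = ((-(2 * π) : ℝ) : ℂ) by push_cast; rfl, map_mul, Complex.conj_ofReal, map_pow]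
    simp only [map_mul, map_div₀, map_one, e, e2, ee_neg]
    ring
  have := congrArg Complex.re h1
  simp at this; linarith

lemma X_int : Integrable (fun r : ℝ => 1 / ln r * ee (ln r)) := by
  have h := (good_const 1).int (s := 1/4) (by norm_num) le_rfl
  refine (h.norm.const_mul 4).mono' ?_ ?_
  · apply Continuous.aestronglyMeasurable
    have hl : Continuous ln := by unfold ln; fun_prop
    refine (continuous_const.div hl fun r h0 => ?_).mul (ee_diff.continuous.comp hl)
    have := ln_im r; rw [h0] at this; norm_num at this
  · refine Filter.Eventually.of_forall fun r => ?_
    have : 1 / 4 ≤ ‖ln r‖ := by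
      have := Complex.abs_im_le_norm (ln r); rw [ln_im, abs_of_pos (by norm_num)] at this; exact this
    rw [norm_mul, norm_div, norm_one, one_mul]
    change _ ≤ 4 * ‖ee (ln r)‖
    gcongr
    rw [div_le_iff₀ (by linarith)]; linarith

lemma N_re : (∫ r : ℝ, GG r * ee r).re = √2 / 16 := by
  have sG : ∫ r : ℝ, GG r * ee r = ∫ r : ℝ, GG (ln r) * ee (ln r) := good_GG.shift
  have sH : ∫ r : ℝ, HH r * ee r = ∫ r : ℝ, HH (ln r) * ee (ln r) := good_HH.shift
  have sI : ∫ r : ℝ, (r : ℂ) * ee r = ∫ r : ℝ, (ln r) * ee (ln r) := good_id.shift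
  have iG : Integrable (fun r : ℝ => GG (ln r) * ee (ln r)) := good_GG.int (by norm_num) le_rfl
  have iH : Integrable (fun r : ℝ => HH (ln r) * ee (ln r)) := good_HH.int (by norm_num) le_rfl
  have iI : Integrable (fun r : ℝ => (ln r) * ee (ln r)) := good_id.int (by norm_num) le_rfl
  have iG' := iG.comp_sub_left (1/2)
  have iI' := iI.comp_sub_left (1/2)
  have rG := integral_sub_left_eq_self (fun r : ℝ => GG (ln r) * ee (ln r)) volume (1/2)
  have rI := integral_sub_left_eq_self (fun r : ℝ => ln r * ee (ln r)) volume (1/2)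
  have iX := X_int.const_mul (1 / (4 * π) : ℂ)
  have key : ∫ r : ℝ, (GG (ln (1/2 - r)) * ee (ln (1/2 - r)) + GG (ln r) * ee (ln r)) =
     ∫ r : ℝ, (-(ln (1/2 - r) * ee (ln (1/2 - r))) + HH (ln r) * ee (ln r) + (1 / (4 * π)) * (1 / ln r * ee (ln r))) := by
    congr 1; funext r
    rw [ln_refl]; exact pointwise (ln_im r)
  have iI'' : Integrable (fun r : ℝ => -(ln (1/2 - r) * ee (ln (1/2 - r)))) := iI'.neg
  rw [integral_add iG' iG, integral_add (f := fun r : ℝ => -(ln (1/2 - r) * ee (ln (1/2 - r))) + HH (ln r) * ee (ln r)) (iI''.add iH) iX, integral_add iI'' iH, integral_neg, rG, rI,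
    integral_const_mul, ← sG, ← sH, ← sI, int_id, int_HH] at key
  have h := congrArg Complex.re key
  have hX := X_re
  set X := ∫ r : ℝ, 1 / ln r * ee (ln r)
  have e : ((1 / (4 * π) : ℂ) * X).re = 0 := by
    rw [show (1 / (4 * π) : ℂ) = ((1 / (4 * π) : ℝ) : ℂ) by push_cast; ring, Complex.re_ofReal_mul, hX, mul_zero]
  have e2 : (aa / 4 * ((√2 / 2 : ℝ) : ℂ)).re = √2 / 8 := by
    rw [mul_comm, Complex.re_ofReal_mul]; simp [aa]; ring
  rw [Complex.add_re, Complex.add_re, Complex.add_re, e, e2] at h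
  simp at h
  linarith

lemma phiF_neg {z : ℂ} (h : |z.im| < 1 ∨ z.re ≠ 0) : phiF (-z) = phiF z + z := by
  by_cases hz : z = 0
  · simp [hz]
  · rw [phiF_eq, phiF_eq z, kapF_neg z h hz]; ring

lemma half_int : ∫ r in Set.Ioi (0:ℝ), GG r * ee r = ((∫ r : ℝ, GG r * ee r) - 1 / (4 * π)) / 2 := by
  have i := real_int good_GG
  have h1 := intervalIntegral.integral_Iic_add_Ioi (b := (0:ℝ)) (i.integrableOn) (i.integrableOn)
  have h2 := integral_comp_neg_Ioi (0:ℝ) (fun r : ℝ => GG r * ee r)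
  rw [neg_zero] at h2
  have h3 : ∀ r : ℝ, GG ((-r : ℝ) : ℂ) * ee ((-r : ℝ) : ℂ) = GG r * ee r + r * ee r := by
    intro r
    have := phiF_neg (z := aa * r) (strip_ok (by simp) (by simp))
    have ha := aa_ne
    simp only [Complex.ofReal_neg, ee_neg, GG, mul_neg, this]
    field_simp
  simp_rw [h3] at h2
  rw [integral_add i.integrableOn (real_int good_id).integrableOn] at h2
  have h4 : ∫ r in Set.Ioi (0:ℝ), (r : ℂ) * ee r = 1 / (4 * π) := by
    have := integral_mul_cexp_neg_mul_sq (b := ((2 * π : ℝ) : ℂ)) (by simp [Real.pi_pos])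
    unfold ee
    push_cast at this
    rw [this]
    rw [← mul_assoc]; norm_num
  rw [h4] at h2
  rw [← h1, ← h2]
  ring

def fF (z : ℂ) : ℂ := 2 * phiF z * Complex.exp (Complex.I * π * z ^ 2)

lemma fF_ray (r : ℝ) : fF (aa * r) * aa = 4 * Complex.I * (GG r * ee r) := by
  have : Complex.I * π * (aa * r) ^ 2 = -(2 * π) * r ^ 2 := by
    rw [mul_pow, aa_sq]; linear_combination (2 * π * (r:ℂ) ^ 2) * Complex.I_sq
  have ha := aa_ne
  rw [fF, GG, ee, this]
  field_simp
  linear_combination (2 * phiF (aa * r)) * aa_sq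

lemma fF_diff {z : ℂ} (h : |z.im| < 1 ∨ z.re ≠ 0) : DifferentiableAt ℂ fF z := by
  have := phiF_diff h
  unfold fF
  fun_prop

lemma exp_lower {x : ℝ} (hx : 0 ≤ x) : x * Real.exp (x / 2) ≤ Real.exp x - 1 := by
  have h := Real.self_le_sinh_iff.2 (by linarith : 0 ≤ x / 2)
  rw [Real.sinh_eq] at h
  have h2 : Real.exp x = Real.exp (x / 2) * Real.exp (x / 2) := by rw [← Real.exp_add]; ring_nf
  have h3 : Real.exp (-(x / 2)) * Real.exp (x / 2) = 1 := by rw [← Real.exp_add]; simp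
  nlinarith [Real.exp_pos (x / 2)]

lemma fF_bound {z : ℂ} (h0 : 0 ≤ z.im) (h1 : z.im ≤ z.re) (h2 : 0 < z.re) :
    ‖fF z‖ ≤ 2 * Real.exp (-(π * z.re)) := by
  have hz : z ≠ 0 := by rintro rfl; simp at h2
  have hw : ‖Complex.exp (2 * π * z)‖ = Real.exp (2 * π * z.re) := by
    rw [Complex.norm_exp]; simp
  have hE : ‖Complex.exp (Complex.I * π * z ^ 2)‖ ≤ 1 := by
    rw [Complex.norm_exp, Real.exp_le_one_iff]
    simp [pow_two]
    have := mul_nonneg Real.pi_pos.le (mul_nonneg h0 h2.le)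
    nlinarith
  have hl := exp_lower (x := 2 * π * z.re) (by positivity)
  rw [show 2 * π * z.re / 2 = π * z.re by ring] at hl
  have := norm_sub_norm_le (Complex.exp (2 * π * z)) 1
  rw [hw, norm_one] at this
  have hn : ‖z‖ ≤ 2 * z.re := by
    have := Complex.norm_le_abs_re_add_abs_im z
    rw [abs_of_nonneg h0, abs_of_pos h2] at this; linarith
  have hp : 0 < 2 * π * z.re * Real.exp (π * z.re) := by positivity
  rw [fF, phiF_ne hz, norm_mul, norm_mul, norm_div, Complex.norm_ofNat]
  have h3 : ‖z‖ / ‖Complex.exp (2 * π * z) - 1‖ ≤ Real.exp (-(π * z.re)) := by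
    rw [div_le_iff₀ (by linarith)]
    calc ‖z‖ ≤ 2 * z.re := hn
      _ ≤ 2 * π * z.re := by nlinarith [Real.pi_gt_three]
      _ = Real.exp (-(π * z.re)) * (2 * π * z.re * Real.exp (π * z.re)) := by
        rw [Real.exp_neg]; field_simp
      _ ≤ _ := by gcongr; linarith
  calc _ ≤ 2 * Real.exp (-(π * z.re)) * 1 := by gcongr
    _ = _ := by ring

lemma fF_real_int : IntegrableOn (fun t : ℝ => fF t) (Set.Ioi 0) := by
  have h : IntegrableOn (fun t : ℝ => 2 * Real.exp (-π * t)) (Set.Ioi 0) :=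
    (integrableOn_exp_mul_Ioi (neg_lt_zero.2 Real.pi_pos) 0).const_mul 2
  refine h.mono' ?_ ?_
  · apply Continuous.aestronglyMeasurable
    rw [continuous_iff_continuousAt]
    intro r
    exact ContinuousAt.comp (f := fun r : ℝ => (r : ℂ)) (x := r) (fF_diff (by simp)).continuousAt (by fun_prop)
  · filter_upwards [ae_restrict_mem measurableSet_Ioi] with t ht
    have := fF_bound (z := t) (by simp) (by simpa using ht.le) (by simpa using ht)
    simpa using this

lemma rotate : ∫ t in Set.Ioi (0:ℝ), fF t = 4 * Complex.I * ∫ r in Set.Ioi (0:ℝ), GG r * ee r := by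
  set T : Set ℂ := {z | 0 ≤ z.im ∧ z.im ≤ z.re} with hT
  have hTc : Convex ℝ T := by
    intro x hx y hy a b ha hb hab
    simp only [hT, Set.mem_setOf_eq, Complex.add_im, Complex.add_re, Complex.real_smul, Complex.im_ofReal_mul,
      Complex.re_ofReal_mul] at *
    constructor
    · have := mul_nonneg ha hx.1; have := mul_nonneg hb hy.1; linarith
    · have := mul_le_mul_of_nonneg_left hx.2 ha; have := mul_le_mul_of_nonneg_left hy.2 hb; linarith
  have hok : ∀ z ∈ T, |z.im| < 1 ∨ z.re ≠ 0 := by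
    intro z hz
    by_cases h : z.re = 0
    · left
      have : z.im = 0 := le_antisymm (by linarith [hz.2]) hz.1
      simp [this]
    · right; exact h
  obtain ⟨F, hF⟩ := hTc.exists_forall_hasDerivWithinAt (𝕜 := ℂ) (f := fF) 
    (fun z hz => (fF_diff (hok z hz)).differentiableWithinAt)
  have iG := (real_int good_GG).const_mul (4 * Complex.I)
  have t0 := intervalIntegral_tendsto_integral_Ioi 0 fF_real_int Filter.tendsto_id
  have t1 := intervalIntegral_tendsto_integral_Ioi 0 (iG.integrableOn) Filter.tendsto_id
  have ftc : ∀ c : ℂ, c ∈ T → ∀ R : ℝ, 0 ≤ R → ∫ t in (0:ℝ)..R, fF (c * t) * c = F (c * R) - F 0 := by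
    intro c hc R hR
    have hm : ∀ t : ℝ, 0 ≤ t → c * t ∈ T := by
      intro t ht
      simp only [hT, Set.mem_setOf_eq, mul_comm c, Complex.im_ofReal_mul, Complex.re_ofReal_mul]
      exact ⟨mul_nonneg ht hc.1, mul_le_mul_of_nonneg_left hc.2 ht⟩
    have hlin : ∀ t : ℝ, HasDerivAt (fun t : ℝ => c * (t : ℂ)) c t := fun t => by
      simpa using (Complex.ofRealCLM.hasDerivAt (x := t)).const_mul c
    have hd : ∀ t ∈ Set.Icc 0 R, HasDerivWithinAt (fun t : ℝ => F (c * t)) (fF (c * t) * c) (Set.Icc 0 R) t := by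
      intro t ht
      exact (hF _ (hm t ht.1)).comp t (hlin t).hasDerivWithinAt (fun s hs => hm s hs.1)
    have := intervalIntegral.integral_eq_sub_of_hasDeriv_right_of_le hR 
      (f := fun t : ℝ => F (c * t)) (f' := fun t : ℝ => fF (c * t) * c)
      (fun t ht => (hd t ht).continuousWithinAt) 
      (fun t ht => ((hd t (Set.Ioo_subset_Icc_self ht)).hasDerivAt (Icc_mem_nhds ht.1 ht.2)).hasDerivWithinAt) ?_
    · simpa using this
    · apply ContinuousOn.intervalIntegrable
      rw [Set.uIcc_of_le hR]
      intro t ht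
      refine ContinuousAt.continuousWithinAt ?_
      refine ContinuousAt.mul ?_ continuousAt_const
      exact ContinuousAt.comp (f := fun t : ℝ => c * (t : ℂ)) (x := t) (fF_diff (hok _ (hm t ht.1))).continuousAt (by fun_prop)
  have hs : Filter.Tendsto (fun R : ℝ => (∫ t in (0:ℝ)..R, 4 * Complex.I * (GG t * ee t)) - ∫ t in (0:ℝ)..R, fF t) 
      Filter.atTop (nhds 0) := by
    have hl := (Real.tendsto_pow_mul_exp_neg_atTop_nhds_zero 1).const_mul 2
    rw [mul_zero] at hl
    refine squeeze_zero_norm' ?_ hl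
    filter_upwards [Filter.eventually_gt_atTop 0] with R hR
    have e1 := ftc 1 (by simp [hT]) R hR.le
    have e2 := ftc aa (by simp [hT, aa]) R hR.le
    simp only [one_mul, mul_one] at e1
    simp_rw [fF_ray] at e2
    rw [e1, e2, sub_sub_sub_cancel_right]
    set s : Set ℂ := {z | z.re = R ∧ 0 ≤ z.im ∧ z.im ≤ R} with hsdef
    have hsc : Convex ℝ s := by
      intro x hx y hy a b ha hb hab
      simp only [hsdef, Set.mem_setOf_eq, Complex.add_im, Complex.add_re, Complex.real_smul, Complex.im_ofReal_mul,
        Complex.re_ofReal_mul] at *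
      refine ⟨?_, ?_, ?_⟩
      · rw [hx.1, hy.1, ← add_mul, hab, one_mul]
      · have := mul_nonneg ha hx.2.1; have := mul_nonneg hb hy.2.1; linarith
      · have := mul_le_mul_of_nonneg_left hx.2.2 ha; have := mul_le_mul_of_nonneg_left hy.2.2 hb; 
        have : a * R + b * R = R := by rw [← add_mul, hab, one_mul]
        linarith
    have hsT : s ⊆ T := fun z hz => ⟨hz.2.1, by rw [hz.1]; exact hz.2.2⟩
    have := hsc.norm_image_sub_le_of_norm_hasDerivWithin_le (f := F) (f' := fF) (C := 2 * Real.exp (-(π * R))) 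
      (x := (R : ℂ)) (y := aa * R)
      (fun z hz => (hF z (hsT hz)).mono hsT) 
      (fun z hz => by
        have := fF_bound (z := z) hz.2.1 (by rw [hz.1]; exact hz.2.2) (by rw [hz.1]; exact hR)
        rwa [hz.1] at this)
      (by simp [hsdef, hR.le]) (by simp [hsdef, aa, hR.le])
    refine this.trans ?_
    have hn : ‖aa * R - R‖ = R := by
      rw [show aa * R - R = Complex.I * R by rw [aa]; ring]
      simp [abs_of_pos hR]
    rw [hn, pow_one]
    have : Real.exp (-(π * R)) ≤ Real.exp (-R) := by
      apply Real.exp_le_exp.2; nlinarith [Real.pi_gt_three]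
    nlinarith
  have := tendsto_nhds_unique (t1.sub t0) hs
  rw [sub_eq_zero] at this
  rw [← this, integral_const_mul]

end

theorem stmt17 :
    ∫ x in Set.Ioi (0:ℝ), Real.sin (π * x) / (Real.exp (2 * π * Real.sqrt x) - 1) = (π * Real.sqrt 2 - 4) / (8 * π) := by
  rw [← integral_comp_rpow_Ioi_of_pos (p := 2) two_pos]
  have h1 : ∫ x in Set.Ioi (0:ℝ), (2 * x ^ ((2:ℝ) - 1)) • (Real.sin (π * x ^ (2:ℝ)) / (Real.exp (2 * π * Real.sqrt (x ^ (2:ℝ))) - 1)) =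
      ∫ x in Set.Ioi (0:ℝ), (fF x).im := by
    refine setIntegral_congr_fun measurableSet_Ioi fun x hx => ?_
    have hx0 : (0:ℝ) < x := hx
    have hx' : (x : ℂ) ≠ 0 := by exact_mod_cast hx0.ne'
    have e1 : Complex.I * π * (x:ℂ) ^ 2 = ((π * x ^ 2 : ℝ) : ℂ) * Complex.I := by push_cast; ring
    have e2 : (2 * ((x : ℂ) / (Complex.exp (2 * π * x) - 1))) = ((2 * (x / (Real.exp (2 * π * x) - 1)) : ℝ) : ℂ) := by
      push_cast; rfl
    simp only [fF, phiF_ne hx']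
    rw [e1, e2, Complex.im_ofReal_mul, Complex.exp_ofReal_mul_I_im, Real.rpow_two, Real.sqrt_sq hx0.le,
      show (2:ℝ) - 1 = 1 by norm_num, Real.rpow_one, smul_eq_mul]
    ring
  have h2 : ∫ x in Set.Ioi (0:ℝ), (fF x).im = (∫ x in Set.Ioi (0:ℝ), fF x).im := by
    have := integral_im fF_real_int
    simpa using this
  rw [h1, h2, rotate, half_int]
  have hN := N_re
  set N := ∫ r : ℝ, GG r * ee r
  have e : 4 * Complex.I * ((N - 1 / (4 * π)) / 2) = 2 * Complex.I * N - ((1 / (2 * π) : ℝ) : ℂ) * Complex.I := by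
    push_cast
    have hpi : (π : ℂ) ≠ 0 := by simp [Real.pi_ne_zero]
    field_simp
    ring
  rw [e]
  have : (2 * Complex.I * N - ((1 / (2 * π) : ℝ) : ℂ) * Complex.I).im = 2 * N.re - 1 / (2 * π) := by
    rw [Complex.sub_im, Complex.im_ofReal_mul]; simp
  rw [this, hN]
  field_simp
  ring
end

section
/- ∫₀^∞ sin(2π x)/(exp(2π√x) − 1) dx = (π − 2)/(16π). -/
open Real MeasureTheory

open Complex Filter Topology in
theorem aux_int (f : ℝ → ℂ) (hf : ContinuousOn f (Set.Ici 0)) (C b : ℝ) (hb0 : 0 < b)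
    (hb : ∀ x : ℝ, 1 ≤ x → ‖f x‖ ≤ C * Real.exp (-b * x)) : IntegrableOn f (Set.Ioi 0) := by
  have h1 : IntegrableOn f (Set.Ioc 0 1) :=
    ((hf.mono Set.Icc_subset_Ici_self).integrableOn_Icc).mono_set Set.Ioc_subset_Icc_self
  have h2 : IntegrableOn f (Set.Ioi 1) := by
    refine Integrable.mono' ((exp_neg_integrableOn_Ioi 1 hb0).const_mul C) ?_ ?_
    · exact (hf.mono (fun x hx => by simp at hx ⊢; linarith)).aestronglyMeasurable measurableSet_Ioi
    · filter_upwards [ae_restrict_mem measurableSet_Ioi] with x hx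
      exact hb x (le_of_lt hx)
  rw [← Set.Ioc_union_Ioi_eq_Ioi (zero_le_one)]
  exact h1.union h2

open Complex Filter Topology in
theorem aux_rect (f : ℂ → ℂ) (c : ℝ) (hc : 0 < c)
    (hd : ∀ x y : ℝ, 0 ≤ x → 0 ≤ y → y ≤ c → DifferentiableAt ℂ f (x + y * I))
    (C : ℝ) (hb : ∀ x y : ℝ, 1 ≤ x → 0 ≤ y → y ≤ c → ‖f (x + y * I)‖ ≤ C * Real.exp (-1 * x)) :
    IntegrableOn (fun x : ℝ => f x) (Set.Ioi 0) ∧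
    IntegrableOn (fun x : ℝ => f (x + c * I)) (Set.Ioi 0) ∧
    (∫ x in Set.Ioi (0:ℝ), f x) - (∫ x in Set.Ioi (0:ℝ), f (x + c * I)) =
      I * ∫ y in (0:ℝ)..c, f (y * I) := by
  have i0 : IntegrableOn (fun x : ℝ => f x) (Set.Ioi 0) := by
    refine aux_int _ ?_ C 1 one_pos ?_
    · intro x hx
      have := (hd x 0 hx le_rfl hc.le).continuousAt
      simp only [ofReal_zero, zero_mul, add_zero] at this
      exact (ContinuousAt.comp (f := fun x : ℝ => (x : ℂ)) this (by fun_prop)).continuousWithinAt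
    · intro x hx
      simpa using hb x 0 hx le_rfl hc.le
  have i1 : IntegrableOn (fun x : ℝ => f (x + c * I)) (Set.Ioi 0) := by
    refine aux_int _ ?_ C 1 one_pos ?_
    · intro x hx
      have := (hd x c hx hc.le le_rfl).continuousAt
      exact (ContinuousAt.comp (f := fun x : ℝ => (x + c * I: ℂ)) this (by fun_prop)).continuousWithinAt
    · intro x hx
      simpa using hb x c hx hc.le le_rfl
  refine ⟨i0, i1, ?_⟩
  have key : ∀ R : ℝ, 1 ≤ R → (∫ x in (0:ℝ)..R, f x) - (∫ x in (0:ℝ)..R, f (x + c * I)) +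
      I * (∫ y in (0:ℝ)..c, f (R + y * I)) = I * ∫ y in (0:ℝ)..c, f (y * I) := by
    intro R hR
    have := integral_boundary_rect_eq_zero_of_differentiableOn f 0 (R + c * I) ?_
    · simpa [sub_eq_zero] using this
    · intro z hz
      simp [mem_reProdIm, Set.uIcc_of_le hc.le, Set.uIcc_of_le (zero_le_one.trans hR)] at hz
      have := hd z.re z.im hz.1.1 hz.2.1 hz.2.2
      rw [re_add_im] at this
      exact this.differentiableWithinAt
  have t0 := intervalIntegral_tendsto_integral_Ioi 0 i0 tendsto_id
  have t1 := intervalIntegral_tendsto_integral_Ioi 0 i1 tendsto_id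
  have t2 : Tendsto (fun R : ℝ => I * (∫ y in (0:ℝ)..c, f (R + y * I))) atTop (𝓝 0) := by
    have e0 : Tendsto (fun R : ℝ => C * Real.exp (-1 * R) * |c - 0|) atTop (𝓝 0) := by
      have : Tendsto (fun R : ℝ => Real.exp (-1 * R)) atTop (𝓝 0) := by
        simpa using Real.tendsto_exp_neg_atTop_nhds_zero
      simpa using (this.const_mul C).mul_const |c - 0|
    refine squeeze_zero_norm' ?_ e0
    filter_upwards [eventually_ge_atTop 1] with R hR
    rw [norm_mul, norm_I, one_mul]
    refine intervalIntegral.norm_integral_le_of_norm_le_const fun y hy => ?_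
    rw [Set.uIoc_of_le hc.le] at hy
    exact hb R y hR hy.1.le hy.2
  have t3 := ((t0.sub t1).add t2)
  rw [add_zero] at t3
  refine tendsto_nhds_unique t3 ?_
  refine tendsto_const_nhds.congr' ?_
  filter_upwards [eventually_ge_atTop 1] with R hR
  exact (key R hR).symm

open Complex Filter Topology in
theorem aux_fresnel (c : ℝ) (hc : 0 < c) :
    (∫ x in Set.Ioi (0:ℝ), cexp (2 * π * I * (x + c * I) ^ 2)) +
      I * (∫ y in (0:ℝ)..c, cexp (2 * π * I * (y * I) ^ 2)) = (1 + I) / 4 := by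
  have nrm : ∀ ε x y : ℝ, ‖cexp (-(ε - 2 * π * I) * (x + y * I) ^ 2)‖
      = Real.exp (-4 * π * x * y - ε * (x ^ 2 - y ^ 2)) := by
    intro ε x y
    rw [norm_exp]
    congr 1
    simp [pow_two]
    ring
  have key : ∀ ε : ℝ, 0 < ε →
      (π / (ε - 2 * π * I : ℂ)) ^ (1 / 2 : ℂ) / 2 =
      (∫ x in Set.Ioi (0:ℝ), cexp (-(ε - 2 * π * I) * (x + c * I) ^ 2)) +
      I * (∫ y in (0:ℝ)..c, cexp (-(ε - 2 * π * I) * (y * I) ^ 2)) := by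
    intro ε hε
    have h := (aux_rect (fun z => cexp (-(ε - 2 * π * I) * z ^ 2)) c hc
      (fun x y _ _ _ => by fun_prop) (Real.exp (ε * c ^ 2 + 1 / (4 * ε))) ?_).2.2
    · rw [integral_gaussian_complex_Ioi (by simp [hε])] at h
      rw [← h]; ring
    · intro x y hx hy hyc
      rw [nrm, ← Real.exp_add, Real.exp_le_exp]
      have h1 : 0 ≤ π * x * y := by positivity
      have h2 : y ^ 2 ≤ c ^ 2 := by gcongr
      have h3 : ε * y ^ 2 ≤ ε * c ^ 2 := by gcongr
      have h4 : 0 ≤ ε * (x - 1 / (2 * ε)) ^ 2 := by positivity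
      have h5 : ε * (x - 1 / (2 * ε)) ^ 2 = ε * x ^ 2 - x + 1 / (4 * ε) := by
        field_simp; ring
      linarith
  have hev : ∀ᶠ ε : ℝ in 𝓝[>] 0, 0 < ε ∧ ε < 1 :=
    Ioo_mem_nhdsGT one_pos
  have t0 : Tendsto (fun ε : ℝ => (π / (ε - 2 * π * I : ℂ)) ^ (1 / 2 : ℂ) / 2) (𝓝[>] 0)
      (𝓝 ((π / ((0:ℝ) - 2 * π * I : ℂ)) ^ (1 / 2 : ℂ) / 2)) := by
    refine Tendsto.mono_left ?_ nhdsWithin_le_nhds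
    have e : (π / ((0:ℝ) - 2 * π * I : ℂ)) = I / 2 := by
      have : (π : ℂ) ≠ 0 := by exact_mod_cast pi_ne_zero
      simp
      field_simp
      simp
    have : ContinuousAt (fun ε : ℝ => (π / (ε - 2 * π * I : ℂ)) ^ (1 / 2 : ℂ) / 2) 0 := by
      refine ContinuousAt.div_const (ContinuousAt.cpow ?_ continuousAt_const ?_) _
      · refine ContinuousAt.div continuousAt_const (by fun_prop) ?_
        simp [pi_ne_zero]
      · rw [e]; right; simp
    exact this.tendsto
  have t1 : Tendsto (fun ε : ℝ => ∫ x in Set.Ioi (0:ℝ), cexp (-(ε - 2 * π * I) * (x + c * I) ^ 2))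
      (𝓝[>] 0) (𝓝 (∫ x in Set.Ioi (0:ℝ), cexp (-((0:ℝ) - 2 * π * I) * (x + c * I) ^ 2))) := by
    refine tendsto_integral_filter_of_dominated_convergence
      (fun x => Real.exp (c ^ 2) * Real.exp (-(4 * π * c) * x)) ?_ ?_ ?_ ?_
    · exact Eventually.of_forall fun ε => Continuous.aestronglyMeasurable (by fun_prop)
    · filter_upwards [hev] with ε hε
      filter_upwards [ae_restrict_mem measurableSet_Ioi] with x hx
      rw [nrm, ← Real.exp_add, Real.exp_le_exp]
      have h1 : 0 ≤ ε * x ^ 2 := by have := hε.1; positivity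
      have h3 : ε * c ^ 2 ≤ 1 * c ^ 2 := by have := hε.2; gcongr
      linarith
    · exact (exp_neg_integrableOn_Ioi 0 (by positivity)).const_mul _
    · refine Eventually.of_forall fun x => Tendsto.mono_left ?_ nhdsWithin_le_nhds
      exact Continuous.tendsto (f := fun ε : ℝ => cexp (-(ε - 2 * π * I) * (x + c * I) ^ 2)) (by fun_prop) 0
  have t2 : Tendsto (fun ε : ℝ => ∫ y in (0:ℝ)..c, cexp (-(ε - 2 * π * I) * (y * I) ^ 2))
      (𝓝[>] 0) (𝓝 (∫ y in (0:ℝ)..c, cexp (-((0:ℝ) - 2 * π * I) * (y * I) ^ 2))) := by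
    refine Tendsto.mono_left ?_ nhdsWithin_le_nhds
    exact Continuous.tendsto (f := fun ε : ℝ => ∫ y in (0:ℝ)..c, cexp (-(ε - 2 * π * I) * (y * I) ^ 2)) (intervalIntegral.continuous_parametric_intervalIntegral_of_continuous' (by fun_prop) _ _) 0
  have t3 := t1.add (t2.const_mul I)
  have := tendsto_nhds_unique (t0.congr' (by filter_upwards [hev] with ε hε using key ε hε.1)) t3
  simp only [ofReal_zero, zero_sub, neg_neg] at this
  rw [← this]
  have hs : (π / (-(2 * π * I)) : ℂ) = ((1 + I) / 2) ^ 2 := by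
    have : (π : ℂ) ≠ 0 := by exact_mod_cast pi_ne_zero
    field_simp
    ring_nf
    simp [show I ^ 3 = -I by rw [pow_succ]; simp]
  rw [hs, show (1 / 2 : ℂ) = 2⁻¹ by norm_num, Complex.sq_cpow_two_inv (by simp)]
  ring

open Complex Filter Topology in
theorem aux_moments (c : ℝ) (hc : 0 < c) :
    (∀ k : ℕ, IntegrableOn (fun t : ℝ => (t:ℂ) ^ k * cexp (2 * π * I * t ^ 2 - 4 * π * c * t)) (Set.Ioi 0)) ∧
    4 * π * I * (∫ t in Set.Ioi (0:ℝ), (t:ℂ) ^ 1 * cexp (2 * π * I * t ^ 2 - 4 * π * c * t))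
      - 4 * π * c * (∫ t in Set.Ioi (0:ℝ), (t:ℂ) ^ 0 * cexp (2 * π * I * t ^ 2 - 4 * π * c * t)) = -1 ∧
    (∫ t in Set.Ioi (0:ℝ), (t:ℂ) ^ 0 * cexp (2 * π * I * t ^ 2 - 4 * π * c * t)) +
    4 * π * I * (∫ t in Set.Ioi (0:ℝ), (t:ℂ) ^ 2 * cexp (2 * π * I * t ^ 2 - 4 * π * c * t))
      - 4 * π * c * (∫ t in Set.Ioi (0:ℝ), (t:ℂ) ^ 1 * cexp (2 * π * I * t ^ 2 - 4 * π * c * t)) = 0 := by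
  have nrm : ∀ (k : ℕ) (t : ℝ), 0 < t → ‖(t:ℂ) ^ k * cexp (2 * π * I * t ^ 2 - 4 * π * c * t)‖ =
      t ^ (k:ℝ) * Real.exp (-(4 * π * c) * t) := by
    intro k t ht
    rw [norm_mul, norm_exp, norm_pow, norm_real, norm_of_nonneg ht.le, Real.rpow_natCast]
    congr 2
    simp [pow_two]
  have hi : ∀ k : ℕ, IntegrableOn (fun t : ℝ => (t:ℂ) ^ k * cexp (2 * π * I * t ^ 2 - 4 * π * c * t)) (Set.Ioi 0) := by
    intro k
    have := integrableOn_rpow_mul_exp_neg_mul_rpow (p := 1) (s := k) (b := 4 * π * c)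
      (by have : (0:ℝ) ≤ k := by positivity
          linarith) one_pos (by positivity)
    refine Integrable.mono' this (Continuous.aestronglyMeasurable (by fun_prop)) ?_
    filter_upwards [ae_restrict_mem measurableSet_Ioi] with t ht
    rw [nrm k t ht, Real.rpow_one]
  have ht : ∀ k : ℕ, Tendsto (fun t : ℝ => (t:ℂ) ^ k * cexp (2 * π * I * t ^ 2 - 4 * π * c * t)) atTop (𝓝 0) := by
    intro k
    refine squeeze_zero_norm' ?_ (tendsto_rpow_mul_exp_neg_mul_atTop_nhds_zero k (4 * π * c) (by positivity))
    filter_upwards [eventually_gt_atTop 0] with t ht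
    exact (nrm k t ht).le
  have hE : ∀ t : ℝ, HasDerivAt (fun t : ℝ => cexp (2 * π * I * t ^ 2 - 4 * π * c * t))
      (cexp (2 * π * I * t ^ 2 - 4 * π * c * t) * (4 * π * I * t - 4 * π * c)) t := by
    intro t
    have h : HasDerivAt (fun z : ℂ => cexp (2 * π * I * z ^ 2 - 4 * π * c * z))
      (cexp (2 * π * I * t ^ 2 - 4 * π * c * t) * (4 * π * I * t - 4 * π * c)) t := by
      refine HasDerivAt.cexp ?_
      refine (((hasDerivAt_pow 2 (t:ℂ)).const_mul (2 * π * I)).sub ((hasDerivAt_id (t:ℂ)).const_mul (4 * π * c : ℂ))).congr_deriv ?_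
      push_cast; ring
    exact h.comp_ofReal
  generalize hEE : (fun t : ℝ => cexp (2 * π * I * t ^ 2 - 4 * π * c * t)) = E at hE
  have hEt : ∀ t : ℝ, cexp (2 * π * I * t ^ 2 - 4 * π * c * t) = E t := fun t => by rw [← hEE]
  have hE0 : E 0 = 1 := by rw [← hEE]; simp
  refine ⟨hi, ?_, ?_⟩
  all_goals simp only [hEt] at hi ht hE ⊢
  · have hint : IntegrableOn (fun t : ℝ => 4 * π * I * ((t:ℂ) ^ 1 * E t) - 4 * π * c * ((t:ℂ) ^ 0 * E t)) (Set.Ioi 0) :=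
      ((hi 1).const_mul _).sub ((hi 0).const_mul _)
    have := integral_Ioi_of_hasDerivAt_of_tendsto (m := 0) (hE 0).continuousAt.continuousWithinAt
      (fun t _ => by
        have h := hE t
        rwa [show E t * (4 * π * I * t - 4 * π * c) = 4 * π * I * ((t:ℂ) ^ 1 * E t) - 4 * π * c * ((t:ℂ) ^ 0 * E t) by ring] at h)
      hint (by simpa using ht 0)
    rw [integral_sub ((hi 1).const_mul _) ((hi 0).const_mul _), integral_const_mul, integral_const_mul] at this
    rw [this, hE0]; simp
  · have hint0 : IntegrableOn (fun t : ℝ => (t:ℂ) ^ 0 * E t + 4 * π * I * ((t:ℂ) ^ 2 * E t)) (Set.Ioi 0) :=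
      (hi 0).add ((hi 2).const_mul _)
    have hint : IntegrableOn (fun t : ℝ => (t:ℂ) ^ 0 * E t + 4 * π * I * ((t:ℂ) ^ 2 * E t) - 4 * π * c * ((t:ℂ) ^ 1 * E t)) (Set.Ioi 0) :=
      hint0.sub ((hi 1).const_mul _)
    have hd : ∀ t : ℝ, HasDerivAt (fun t : ℝ => (t:ℂ) ^ 1 * E t) ((t:ℂ) ^ 0 * E t + 4 * π * I * ((t:ℂ) ^ 2 * E t) - 4 * π * c * ((t:ℂ) ^ 1 * E t)) t := by
      intro t
      have h := ((hasDerivAt_pow 1 (t:ℂ)).comp_ofReal.mul (hE t))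
      refine h.congr_deriv ?_
      push_cast; ring
    have := integral_Ioi_of_hasDerivAt_of_tendsto (m := 0) (hd 0).continuousAt.continuousWithinAt
      (fun t _ => hd t) hint (ht 1)
    rw [integral_sub hint0 ((hi 1).const_mul _), integral_add (hi 0) ((hi 2).const_mul _), integral_const_mul, integral_const_mul] at this
    rw [this]; simp

open Complex Filter Topology in
theorem aux_Q : ∃ Q : ℂ → ℂ, Differentiable ℂ Q ∧ (∀ z, z * (z - I) * Q z = cexp (2 * π * z) - 1) ∧
    ∀ z : ℂ, 0 ≤ z.im → z.im ≤ 1 → Q z ≠ 0 := by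
  have hpi : (π : ℂ) ≠ 0 := by exact_mod_cast pi_ne_zero
  set φ : ℂ → ℂ := fun z => cexp (2 * π * z) - 1 with hφ
  have hd : Differentiable ℂ φ := by fun_prop
  have hd1 : Differentiable ℂ (dslope φ 0) := by
    rw [← differentiableOn_univ]
    exact (differentiableOn_dslope univ_mem).2 hd.differentiableOn
  have hd2 : Differentiable ℂ (dslope (dslope φ 0) I) := by
    rw [← differentiableOn_univ]
    exact (differentiableOn_dslope univ_mem).2 hd1.differentiableOn
  have h0 : φ 0 = 0 := by simp [hφ]
  have hI : φ I = 0 := by simp [hφ, Complex.exp_two_pi_mul_I]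
  have e1 : ∀ z, z * dslope φ 0 z = φ z := fun z => by
    simpa using sub_smul_dslope_of_zero h0 z
  have hI1 : dslope φ 0 I = 0 := by
    have := e1 I
    rw [hI] at this
    simpa using this
  have e2 : ∀ z, (z - I) * dslope (dslope φ 0) I z = dslope φ 0 z := fun z => by
    simpa using sub_smul_dslope_of_zero hI1 z
  set Q := dslope (dslope φ 0) I with hQ
  have e3 : ∀ z, z * (z - I) * Q z = φ z := fun z => by rw [mul_assoc, e2, e1]
  refine ⟨Q, hd2, e3, ?_⟩
  have der : ∀ z, (z - I) * Q z + z * Q z + z * (z - I) * deriv Q z = 2 * π * cexp (2 * π * z) := by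
    intro z
    have d1 : HasDerivAt (fun z => z * (z - I) * Q z)
        ((1 * (z - I) + z * 1) * Q z + z * (z - I) * deriv Q z) z :=
      (((hasDerivAt_id z).mul ((hasDerivAt_id z).sub_const I))).mul (hd2 z).hasDerivAt
    have d2 : HasDerivAt φ (cexp (2 * π * z) * (2 * π * 1)) z :=
      (((hasDerivAt_id z).const_mul (2 * π : ℂ)).cexp).sub_const 1
    rw [funext e3] at d1
    have := d1.unique d2
    linear_combination this
  intro z hz0 hz1 hq
  have h3 := e3 z
  rw [hq, mul_zero] at h3
  have h4 : cexp (2 * π * z) = 1 := by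
    simp only [hφ] at h3
    linear_combination -h3
  obtain ⟨n, hn⟩ := Complex.exp_eq_one_iff.1 h4
  have hz : z = n * I := by
    field_simp at hn
    linear_combination hn
  have him : z.im = n := by rw [hz]; simp
  rw [him] at hz0 hz1
  have hn0 : 0 ≤ n := by exact_mod_cast hz0
  have hn1 : n ≤ 1 := by exact_mod_cast hz1
  have hd := der z
  rw [h4, hq] at hd
  have hzz : z * (z - I) = 0 := by
    have : n = 0 ∨ n = 1 := by omega
    rcases this with rfl | rfl <;> simp [hz]
  rw [hzz] at hd
  simp [hpi] at hd

open Complex Filter Topology in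
theorem aux_B (a b : ℝ) :
    4 * π * I * (∫ u in a..b, (u:ℂ) * cexp (2 * π * I * (u * I) ^ 2)) =
      cexp (2 * π * I * (a * I) ^ 2) - cexp (2 * π * I * (b * I) ^ 2) ∧
    4 * π * I * (∫ u in a..b, (u:ℂ) ^ 2 * cexp (2 * π * I * (u * I) ^ 2)) =
      (∫ u in a..b, cexp (2 * π * I * (u * I) ^ 2)) -
      (b * cexp (2 * π * I * (b * I) ^ 2) - a * cexp (2 * π * I * (a * I) ^ 2)) := by
  have hE : ∀ t : ℝ, HasDerivAt (fun t : ℝ => cexp (2 * π * I * (t * I) ^ 2))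
      (cexp (2 * π * I * (t * I) ^ 2) * (- 4 * π * I * t)) t := by
    intro t
    have h : HasDerivAt (fun z : ℂ => cexp (2 * π * I * (z * I) ^ 2))
      (cexp (2 * π * I * (t * I) ^ 2) * (- 4 * π * I * t)) t := by
      refine HasDerivAt.cexp ?_
      refine ((((hasDerivAt_id (t:ℂ)).mul_const I).pow 2).const_mul (2 * π * I)).congr_deriv ?_
      simp only [id]
      push_cast
      linear_combination 4 * π * I * t * I_sq
    exact h.comp_ofReal
  constructor
  · have h := intervalIntegral.integral_eq_sub_of_hasDerivAt (a := a) (b := b) (fun t _ => hE t)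
      (Continuous.intervalIntegrable (by fun_prop) _ _)
    rw [show (fun t : ℝ => cexp (2 * π * I * (t * I) ^ 2) * (- 4 * π * I * t)) = fun t : ℝ =>
      (-4 * π * I) * ((t:ℂ) * cexp (2 * π * I * (t * I) ^ 2)) by ext; ring,
      intervalIntegral.integral_const_mul] at h
    linear_combination -h
  · have h := intervalIntegral.integral_eq_sub_of_hasDerivAt (a := a) (b := b)
      (f := fun t : ℝ => (t:ℂ) * cexp (2 * π * I * (t * I) ^ 2))
      (f' := fun t : ℝ => cexp (2 * π * I * (t * I) ^ 2) - 4 * π * I * ((t:ℂ) ^ 2 * cexp (2 * π * I * (t * I) ^ 2)))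
      (fun t _ => by
        refine ((hasDerivAt_id (t:ℂ)).comp_ofReal.mul (hE t)).congr_deriv ?_
        simp only [id]
        ring)
      (Continuous.intervalIntegrable (by fun_prop) _ _)
    rw [intervalIntegral.integral_sub (Continuous.intervalIntegrable (by fun_prop) _ _)
      (Continuous.intervalIntegrable (by fun_prop) _ _),
      intervalIntegral.integral_const_mul] at h
    linear_combination -h

open Complex Filter Topology in
theorem aux_T (Q : ℂ → ℂ) (hQd : Differentiable ℂ Q) (hQ : ∀ z, z * (z - I) * Q z = cexp (2 * π * z) - 1)
    (hQ0 : ∀ z : ℂ, 0 ≤ z.im → z.im ≤ 1 → Q z ≠ 0) :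
    2 * (∫ y in (0:ℝ)..1, cexp (2 * π * I * (y * I) ^ 2) / Q (y * I)) =
    -(2 * (∫ y in (0:ℝ)..1, ((y:ℂ) - y ^ 2) * cexp (2 * π * I * (y * I) ^ 2)) +
     I * ∫ y in (-(1/2):ℝ)..(1/2), (1 / 4 - (y:ℂ) ^ 2) * cexp (2 * π * I * (y * I) ^ 2)) := by
  set e : ℝ → ℂ := fun y => cexp (2 * π * I * (y * I) ^ 2) with he
  have hec : Continuous e := by fun_prop
  set h : ℝ → ℂ := fun y => e y / Q (y * I) with hh
  have hcont : ContinuousOn h (Set.uIcc 0 1) := by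
    refine ContinuousOn.div hec.continuousOn (hQd.continuous.comp (by fun_prop)).continuousOn ?_
    intro y hy
    rw [Set.uIcc_of_le zero_le_one] at hy
    exact hQ0 _ (by simpa using hy.1) (by simpa using hy.2)
  have hi : IntervalIntegrable h volume 0 1 := hcont.intervalIntegrable
  have hi' : IntervalIntegrable (fun y => h (1 - y)) volume 0 1 := by
    have := (hi.comp_sub_left 1).symm
    simpa using this
  have s1 : (∫ y in (0:ℝ)..1, h (1 - y)) = ∫ y in (0:ℝ)..1, h y := by
    rw [intervalIntegral.integral_comp_sub_left h 1]; simp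
  have s2 : (∫ y in (0:ℝ)..1, (((1 - y : ℝ):ℂ) - (1 - y : ℝ) ^ 2) * e (1 - y)) = ∫ y in (0:ℝ)..1, ((y:ℂ) - y ^ 2) * e y := by
    rw [intervalIntegral.integral_comp_sub_left (fun y : ℝ => ((y:ℂ) - y ^ 2) * e y) 1]; simp
  have s3 : (∫ y in (0:ℝ)..1, (1 / 4 - ((y - 1 / 2 : ℝ):ℂ) ^ 2) * e (y - 1 / 2)) =
      ∫ y in (-(1/2):ℝ)..(1/2), (1 / 4 - (y:ℂ) ^ 2) * e y := by
    rw [intervalIntegral.integral_comp_sub_right (fun y : ℝ => (1 / 4 - (y:ℂ) ^ 2) * e y) (1 / 2)]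
    norm_num
  have key : (∫ y in (0:ℝ)..1, (h y + h (1 - y))) = ∫ y in (0:ℝ)..1,
      -((((y:ℂ) - y ^ 2) * e y + (((1 - y : ℝ):ℂ) - (1 - y : ℝ) ^ 2) * e (1 - y)) +
        I * ((1 / 4 - ((y - 1 / 2 : ℝ):ℂ) ^ 2) * e (y - 1 / 2))) := by
    refine intervalIntegral.integral_congr_ae ?_
    have : ∀ᵐ y : ℝ, y ≠ 1 := by simp [ae_iff]
    filter_upwards [this] with y hy1 hy
    rw [Set.uIoc_of_le zero_le_one] at hy
    have hy2 : y < 1 := lt_of_le_of_ne hy.2 hy1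
    have hq1 := hQ (y * I)
    have hq2 := hQ ((1 - y : ℝ) * I)
    have n1 := hQ0 (y * I) (by simpa using hy.1.le) (by simpa using hy.2)
    have n2 := hQ0 ((1 - y : ℝ) * I) (by simpa using hy.2) (by simpa using hy.1.le)
    set w := cexp (2 * π * I * y) with hw
    have hw0 : w ≠ 0 := Complex.exp_ne_zero _
    have ew1 : cexp (2 * π * (y * I)) = w := by rw [hw]; ring_nf
    have ew2 : cexp (2 * π * ((1 - y : ℝ) * I)) = w⁻¹ := by
      rw [hw, ← Complex.exp_neg, ← mul_one (cexp (-_)), ← Complex.exp_two_pi_mul_I, ← Complex.exp_add]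
      push_cast; ring_nf
    have ee1 : e (1 - y) = e y * w ^ 2 := by
      simp only [he]
      rw [hw, ← Complex.exp_nat_mul, ← Complex.exp_add, ← mul_one (cexp (_ + _)), ← Complex.exp_two_pi_mul_I, ← Complex.exp_add,
        Complex.exp_eq_exp_iff_exists_int]
      refine ⟨-2, ?_⟩
      push_cast
      linear_combination (2 * π * I * (1 - 2 * y)) * I_sq
    have ee2 : I * e (y - 1 / 2) = e y * w := by
      simp only [he]
      nth_rewrite 1 [← Complex.exp_pi_div_two_mul_I]
      rw [hw, ← Complex.exp_add, ← Complex.exp_add]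
      congr 1
      push_cast
      linear_combination (2 * π * I * (1 / 4 - y)) * I_sq
    have yc0 : (y:ℂ) ≠ 0 := by exact_mod_cast hy.1.ne'
    have yc1 : (1 - y:ℂ) ≠ 0 := by
      have : (1 - y) ≠ 0 := by linarith
      exact_mod_cast this
    rw [ew1] at hq1
    rw [ew2] at hq2
    push_cast at hq2 n2
    have hq1' : (y * (1 - y)) * Q (y * I) = w - 1 := by
      linear_combination hq1 - (y * (y - 1) * Q (y * I)) * I_sq
    have hq2' : (y * (1 - y)) * Q ((1 - y) * I) = w⁻¹ - 1 := by
      linear_combination hq2 + (y * (1 - y) * Q ((1 - y) * I)) * I_sq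
    have hw1 : w - 1 ≠ 0 := by
      rw [← hq1']; exact mul_ne_zero (mul_ne_zero yc0 yc1) n1
    have hQ1 : Q (y * I) = (w - 1) / (y * (1 - y)) := by
      rw [← hq1']; field_simp
    have hQ2 : Q ((1 - y) * I) = (w⁻¹ - 1) / (y * (1 - y)) := by
      rw [← hq2']; field_simp
    have hw2 : 1 - w ≠ 0 := by
      intro h; apply hw1; linear_combination -h
    have hw3 : w⁻¹ - 1 = -(w - 1) / w := by field_simp; ring
    simp only [hh]
    rw [show I * ((1 / 4 - ((y - 1 / 2 : ℝ):ℂ) ^ 2) * e (y - 1 / 2)) = (1 / 4 - ((y - 1 / 2 : ℝ):ℂ) ^ 2) * (I * e (y - 1 / 2)) by ring,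
      ee1, ee2]
    push_cast
    rw [hQ1, hQ2, hw3]
    field_simp
    ring
  rw [intervalIntegral.integral_add hi hi', s1, intervalIntegral.integral_neg,
    intervalIntegral.integral_add (Continuous.intervalIntegrable (by fun_prop) _ _) (Continuous.intervalIntegrable (by fun_prop) _ _),
    intervalIntegral.integral_add (Continuous.intervalIntegrable (by fun_prop) _ _) (Continuous.intervalIntegrable (by fun_prop) _ _),
    intervalIntegral.integral_const_mul, s2, s3] at key
  linear_combination key

open Complex Filter Topology in
theorem aux_main :
    IntegrableOn (fun t : ℝ => (t:ℂ) * cexp (2 * π * I * t ^ 2) / (cexp (2 * π * t) - 1)) (Set.Ioi 0) ∧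
    -2 * I * (∫ t in Set.Ioi (0:ℝ), (t:ℂ) * cexp (2 * π * I * t ^ 2) / (cexp (2 * π * t) - 1)) =
      -1 / (4 * π) + (1 - I) / (16 * π) - (1 / 16) * (1 + I / π) * (I - 1) := by
  have hpi : (π : ℂ) ≠ 0 := by exact_mod_cast pi_ne_zero
  obtain ⟨Q, hQd, hQ, hQ0⟩ := aux_Q
  obtain ⟨i0, i1, hr⟩ := aux_rect (fun z => cexp (2 * π * I * z ^ 2) / Q z) 1 one_pos
    (fun x y hx hy hy1 => DifferentiableAt.div (by fun_prop) (hQd _)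
      (hQ0 _ (by simpa using hy) (by simpa using hy1))) 1 (by
    intro x y hx hy hy1
    have n0 := hQ0 (x + y * I) (by simpa using hy) (by simpa using hy1)
    have hq := hQ (x + y * I)
    have nn : ‖cexp (2 * π * (x + y * I)) - 1‖ ≥ Real.exp (2 * π * x) - 1 := by
      refine le_trans ?_ (norm_sub_norm_le _ _)
      rw [Complex.norm_exp]
      simp
    have nE : ‖cexp (2 * π * I * (x + y * I) ^ 2)‖ ≤ 1 := by
      rw [Complex.norm_exp, Real.exp_le_one_iff]
      have : 0 ≤ π * x * y := by positivity
      simp [pow_two]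
      linarith
    have nz : ‖(x + y * I : ℂ)‖ ≤ x + 1 := by
      refine (norm_add_le _ _).trans ?_
      simp [abs_of_nonneg hy, abs_of_nonneg (zero_le_one.trans hx), hy1]
    have nz1 : ‖(x + y * I - I : ℂ)‖ ≤ x + 1 := by
      rw [show (x + y * I - I : ℂ) = x + ((y - 1 : ℝ):ℂ) * I by push_cast; ring]
      refine (norm_add_le _ _).trans ?_
      rw [norm_mul, norm_real, norm_real, norm_I, mul_one, Real.norm_eq_abs, Real.norm_eq_abs,
        abs_of_nonneg (zero_le_one.trans hx)]
      have : |y - 1| ≤ 1 := abs_le.2 ⟨by linarith, by linarith⟩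
      linarith
    rw [← hq, norm_mul, norm_mul] at nn
    have hQpos : 0 < ‖Q (x + y * I)‖ := norm_pos_iff.2 n0
    have h1 : Real.exp (2 * π * x) - 1 ≤ (x + 1) * (x + 1) * ‖Q (x + y * I)‖ :=
      nn.le.trans (by gcongr)
    have h2 : x + 1 ≤ Real.exp x := Real.add_one_le_exp x
    have h3 : Real.exp (2 * π * x) - 1 ≤ Real.exp x * Real.exp x * ‖Q (x + y * I)‖ :=
      h1.trans (by gcongr)
    have h4 : Real.exp (4 * x) ≤ Real.exp (2 * π * x) := by
      rw [Real.exp_le_exp]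
      have := pi_gt_three
      nlinarith
    have h5 : Real.exp (4 * x) = Real.exp x ^ 4 := by rw [← Real.exp_nat_mul]; norm_num
    have h6 : 2 ≤ Real.exp x := by linarith
    have h7 : Real.exp x ^ 3 ≤ Real.exp x ^ 4 - 1 := by
      have : (1:ℝ) ≤ Real.exp x ^ 3 := one_le_pow₀ (by linarith)
      nlinarith
    have h8 : Real.exp x ^ 2 * Real.exp x ≤ Real.exp x ^ 2 * ‖Q (x + y * I)‖ := by
      calc _ = Real.exp x ^ 3 := by ring
        _ ≤ _ := h7
        _ ≤ Real.exp (2 * π * x) - 1 := by rw [← h5]; linarith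
        _ ≤ _ := h3
        _ = _ := by ring
    have h9 : Real.exp x ≤ ‖Q (x + y * I)‖ := le_of_mul_le_mul_left h8 (by positivity)
    rw [norm_div, one_mul, neg_one_mul, Real.exp_neg, div_le_iff₀ hQpos]
    refine nE.trans ?_
    rw [inv_mul_eq_div, le_div_iff₀ (Real.exp_pos x)]
    linarith)
  have hT := aux_T Q hQd hQ hQ0
  obtain ⟨mi, m1, m2⟩ := aux_moments 1 one_pos
  obtain ⟨mi', m1', m2'⟩ := aux_moments (1 / 2) (by norm_num)
  set E1 : ℝ → ℂ := fun t => cexp (2 * π * I * t ^ 2 - 4 * π * (1:ℝ) * t) with hE1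
  set E2 : ℝ → ℂ := fun t => cexp (2 * π * I * t ^ 2 - 4 * π * ((1 / 2 : ℝ) : ℂ) * t) with hE2
  have pt : ∀ t : ℝ, 0 < t → (t:ℂ) * cexp (2 * π * I * t ^ 2) / (cexp (2 * π * t) - 1) =
      (I / 2) * ((cexp (2 * π * I * t ^ 2) / Q t - cexp (2 * π * I * (t + (1:ℝ) * I) ^ 2) / Q (t + (1:ℝ) * I))
       - (((t:ℂ) ^ 2 * E1 t + I * ((t:ℂ) ^ 1 * E1 t)) + ((t:ℂ) ^ 2 * E2 t + I * ((t:ℂ) ^ 1 * E2 t)))) := by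
    intro t ht
    have hq1 := hQ t
    have hq2 := hQ (t + (1:ℝ) * I)
    have n1 := hQ0 t (by simp) (by simp)
    have n2 := hQ0 (t + (1:ℝ) * I) (by simp) (by simp)
    set q := cexp (2 * π * t) with hq
    have q0 : q ≠ 0 := Complex.exp_ne_zero _
    have q1 : q - 1 ≠ 0 := by
      have : Real.exp (2 * π * t) - 1 > 0 := by
        have : 0 < 2 * π * t := by positivity
        have := Real.one_lt_exp_iff.2 this
        linarith
      rw [hq]
      exact_mod_cast this.ne'
    have e2 : cexp (2 * π * (t + (1:ℝ) * I)) = q := by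
      rw [hq, ← mul_one (cexp (2 * π * t)), ← Complex.exp_two_pi_mul_I, ← Complex.exp_add]
      push_cast; ring_nf
    rw [e2] at hq2
    have f1 : E1 t = cexp (2 * π * I * t ^ 2) / q ^ 2 := by
      simp only [hE1]
      rw [hq, ← Complex.exp_nat_mul, ← Complex.exp_sub]
      congr 1; push_cast; ring
    have f2 : E2 t = cexp (2 * π * I * t ^ 2) / q := by
      simp only [hE2]
      rw [hq, ← Complex.exp_sub]
      congr 1; push_cast; ring
    have f3 : cexp (2 * π * I * (t + (1:ℝ) * I) ^ 2) = cexp (2 * π * I * t ^ 2) / q ^ 2 := by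
      rw [hq, ← Complex.exp_nat_mul, ← Complex.exp_sub, Complex.exp_eq_exp_iff_exists_int]
      refine ⟨-1, ?_⟩
      push_cast
      linear_combination (4 * π * t + 2 * π * I) * I_sq
    have tc : (t:ℂ) ≠ 0 := by exact_mod_cast ht.ne'
    have g1 : 1 / Q t = t * (t - I) / (q - 1) := by
      rw [← hq1] at q1 ⊢
      rw [div_eq_div_iff n1 q1]
      ring
    have g2 : 1 / Q (t + (1:ℝ) * I) = t * (t + I) / (q - 1) := by
      rw [← hq2] at q1 ⊢
      rw [div_eq_div_iff n2 q1]
      push_cast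
      ring
    rw [f1, f2, f3, div_eq_mul_one_div _ (Q t), div_eq_mul_one_div _ (Q (t + (1:ℝ) * I)), g1, g2]
    field_simp
    ring_nf
    simp only [I_sq]
    ring
  have iD : IntegrableOn (fun t : ℝ => cexp (2 * π * I * t ^ 2) / Q t - cexp (2 * π * I * (t + (1:ℝ) * I) ^ 2) / Q (t + (1:ℝ) * I)) (Set.Ioi 0) := i0.sub i1
  have iM1 : IntegrableOn (fun t : ℝ => (t:ℂ) ^ 2 * E1 t + I * ((t:ℂ) ^ 1 * E1 t)) (Set.Ioi 0) := (mi 2).add ((mi 1).const_mul I)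
  have iM2 : IntegrableOn (fun t : ℝ => (t:ℂ) ^ 2 * E2 t + I * ((t:ℂ) ^ 1 * E2 t)) (Set.Ioi 0) := (mi' 2).add ((mi' 1).const_mul I)
  have iM : IntegrableOn (fun t : ℝ => ((t:ℂ) ^ 2 * E1 t + I * ((t:ℂ) ^ 1 * E1 t)) + ((t:ℂ) ^ 2 * E2 t + I * ((t:ℂ) ^ 1 * E2 t))) (Set.Ioi 0) := iM1.add iM2
  have iA := (iD.sub iM).const_mul (I / 2)
  refine ⟨IntegrableOn.congr_fun iA (fun t ht => (pt t ht).symm) measurableSet_Ioi, ?_⟩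
  rw [setIntegral_congr_fun measurableSet_Ioi (fun t ht => pt t ht), integral_const_mul,
    integral_sub iD iM, integral_sub i0 i1, integral_add iM1 iM2,
    integral_add (mi 2) ((mi 1).const_mul I), integral_add (mi' 2) ((mi' 1).const_mul I),
    integral_const_mul, integral_const_mul, hr]
  -- Fresnel
  have F1 := aux_fresnel 1 one_pos
  have F2 := aux_fresnel (1 / 2) (by norm_num)
  have c1 : ∀ x : ℝ, cexp (2 * π * I * (x + (1:ℝ) * I) ^ 2) = (x:ℂ) ^ 0 * E1 x := by
    intro x
    simp only [hE1]
    rw [pow_zero, one_mul, Complex.exp_eq_exp_iff_exists_int]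
    refine ⟨-1, ?_⟩
    push_cast
    linear_combination (4 * π * x + 2 * π * I) * I_sq
  have c2 : ∀ x : ℝ, cexp (2 * π * I * (x + ((1 / 2 : ℝ) : ℂ) * I) ^ 2) = -I * ((x:ℂ) ^ 0 * E2 x) := by
    intro x
    simp only [hE2]
    rw [pow_zero, one_mul, ← Complex.exp_neg_pi_div_two_mul_I, ← Complex.exp_add]
    congr 1
    push_cast
    linear_combination (2 * π * x + π * I / 2) * I_sq
  simp only [c1] at F1
  simp only [c2] at F2
  rw [integral_const_mul] at F2
  obtain ⟨B1, B2⟩ := aux_B 0 1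
  obtain ⟨-, B3⟩ := aux_B (-(1 / 2)) (1 / 2)
  set e : ℝ → ℂ := fun y => cexp (2 * π * I * (y * I) ^ 2) with he
  have hec : Continuous e := by fun_prop
  have v0 : cexp (2 * π * I * ((0:ℝ) * I) ^ 2) = 1 := by simp
  have v1 : cexp (2 * π * I * ((1:ℝ) * I) ^ 2) = 1 := by
    rw [Complex.exp_eq_one_iff]; refine ⟨-1, ?_⟩; simp
  have v2 : cexp (2 * π * I * (((1 / 2 : ℝ):ℂ) * I) ^ 2) = -I := by
    rw [← Complex.exp_neg_pi_div_two_mul_I]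
    congr 1
    push_cast
    linear_combination (π * I / 2) * I_sq
  have v3 : cexp (2 * π * I * (((-(1 / 2) : ℝ):ℂ) * I) ^ 2) = -I := by
    rw [← v2]
    congr 1
    push_cast
    ring
  have ev : (∫ u in (-(1 / 2):ℝ)..(1 / 2), e u) = 2 * ∫ u in (0:ℝ)..(1 / 2), e u := by
    rw [← intervalIntegral.integral_add_adjacent_intervals (b := 0) (hec.intervalIntegrable _ _) (hec.intervalIntegrable _ _)]
    have : (∫ u in (-(1 / 2):ℝ)..0, e u) = ∫ u in (0:ℝ)..(1 / 2), e u := by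
      have h := intervalIntegral.integral_comp_neg (a := 0) (b := 1 / 2) e
      rw [neg_zero] at h
      rw [← h]
      congr 1
      ext u
      simp [he]
    rw [this]; ring
  rw [v0, v1] at B1
  rw [v1] at B2
  rw [v2, v3, ev] at B3
  have w1 : (∫ y in (0:ℝ)..1, ((y:ℂ) - y ^ 2) * e y) = (∫ y in (0:ℝ)..1, (y:ℂ) * e y) - ∫ y in (0:ℝ)..1, (y:ℂ) ^ 2 * e y := by
    rw [← intervalIntegral.integral_sub (Continuous.intervalIntegrable (by fun_prop) _ _) (Continuous.intervalIntegrable (by fun_prop) _ _)]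
    congr 1; ext; ring
  have w2 : (∫ y in (-(1 / 2):ℝ)..(1 / 2), (1 / 4 - (y:ℂ) ^ 2) * e y) = (1 / 4) * (2 * ∫ u in (0:ℝ)..(1 / 2), e u) - ∫ y in (-(1 / 2):ℝ)..(1 / 2), (y:ℂ) ^ 2 * e y := by
    rw [← ev, ← intervalIntegral.integral_const_mul, ← intervalIntegral.integral_sub (Continuous.intervalIntegrable (by fun_prop) _ _) (Continuous.intervalIntegrable (by fun_prop) _ _)]
    congr 1; ext; ring
  rw [w1, w2] at hT
  change 2 * (∫ y in (0:ℝ)..1, e y / Q (y * I)) = _ at hT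
  change -2 * I * (I / 2 * (I * (∫ y in (0:ℝ)..1, e y / Q (y * I)) - _)) = _
  generalize (∫ y in (0:ℝ)..1, e y / Q (y * I)) = T at *
  generalize (∫ y in (0:ℝ)..1, (y:ℂ) * e y) = X1 at *
  generalize (∫ y in (0:ℝ)..1, (y:ℂ) ^ 2 * e y) = X2 at *
  generalize (∫ y in (-(1 / 2):ℝ)..(1 / 2), (y:ℂ) ^ 2 * e y) = U2 at *
  generalize (∫ y in (0:ℝ)..(1 / 2), e y) = K2 at *
  generalize (∫ y in (0:ℝ)..1, e y) = K1 at *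
  generalize (∫ t in Set.Ioi (0:ℝ), (t:ℂ) ^ 0 * E1 t) = M0 at *
  generalize (∫ t in Set.Ioi (0:ℝ), (t:ℂ) ^ 1 * E1 t) = M1 at *
  generalize (∫ t in Set.Ioi (0:ℝ), (t:ℂ) ^ 2 * E1 t) = M2 at *
  generalize (∫ t in Set.Ioi (0:ℝ), (t:ℂ) ^ 0 * E2 t) = N0 at *
  generalize (∫ t in Set.Ioi (0:ℝ), (t:ℂ) ^ 1 * E2 t) = N1 at *
  generalize (∫ t in Set.Ioi (0:ℝ), (t:ℂ) ^ 2 * E2 t) = N2 at *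
  clear_value E1 E2 e
  clear pt iD iM1 iM2 iM iA c1 c2 v0 v1 v2 v3 ev w1 w2 mi mi' i0 i1 hr hE1 hE2 he hec hQ hQ0 hQd
  push_cast at *
  have hI4 : (4 * π * I : ℂ) ≠ 0 := by simp [hpi]
  have I3 : I⁻¹ = -I := by simp
  have rX1 : X1 = 0 := by
    have : 4 * π * I * X1 = 0 := by rw [B1]; ring
    exact (mul_eq_zero.1 this).resolve_left hI4
  have inv : ∀ a b : ℂ, 4 * π * I * a = b → a = -I / (4 * π) * b := by
    intro a b h
    rw [← h]
    field_simp
    linear_combination a * I_sq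
  have rX2 := inv _ _ B2
  have rU2 := inv _ _ B3
  have rM1 := inv M1 (-1 + 4 * π * M0) (by linear_combination m1)
  have rM2 := inv M2 (4 * π * M1 - M0) (by linear_combination m2)
  have rN1 := inv N1 (-1 + 2 * π * N0) (by linear_combination m1')
  have rN2 := inv N2 (2 * π * N1 - N0) (by linear_combination m2')
  have rT : T = -(2 * (X1 - X2) + I * (1 / 4 * (2 * K2) - U2)) / 2 := by linear_combination hT / 2
  have rM0 : M0 = (1 + I) / 4 - I * K1 := by linear_combination F1
  have rN0 : N0 = I * (1 + I) / 4 + K2 := by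
    linear_combination I * F2 + (N0 - K2) * I_sq
  rw [rT, rX1, rX2, rU2, rM2, rN2, rM1, rN1, rM0, rN0]
  field_simp
  ring_nf
  have I3 : I ^ 3 = -I := by rw [pow_succ, I_sq]; ring
  have I4 : I ^ 4 = 1 := I_pow_four
  have I5 : I ^ 5 = I := by rw [pow_succ, I4]; ring
  have I6 : I ^ 6 = -1 := by rw [pow_succ, I5, ← pow_two, I_sq]
  simp only [I_sq, I3, I4, I5, I6]
  ring

theorem stmt18 :
    ∫ x in Set.Ioi (0:ℝ), Real.sin (2 * π * x) / (Real.exp (2 * π * Real.sqrt x) - 1) = (π - 2) / (16 * π) := by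
  obtain ⟨hi, hJ⟩ := aux_main
  rw [← integral_comp_rpow_Ioi_of_pos (p := 2) (by norm_num)]
  have h1 : ∀ t ∈ Set.Ioi (0:ℝ), (2 * t ^ ((2:ℝ) - 1)) • (Real.sin (2 * π * t ^ (2:ℝ)) / (Real.exp (2 * π * Real.sqrt (t ^ (2:ℝ))) - 1)) =
      2 * RCLike.im ((t:ℂ) * Complex.exp (2 * π * Complex.I * t ^ 2) / (Complex.exp (2 * π * t) - 1)) := by
    intro t ht
    have ht' : (0:ℝ) ≤ t := le_of_lt ht
    rw [show (2:ℝ) - 1 = 1 by norm_num, Real.rpow_one, show t ^ (2:ℝ) = t ^ 2 by norm_cast,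
      Real.sqrt_sq ht']
    have e1 : (t:ℂ) * Complex.exp (2 * π * Complex.I * t ^ 2) / (Complex.exp (2 * π * t) - 1) =
      ((t / (Real.exp (2 * π * t) - 1) : ℝ) : ℂ) * Complex.exp ((2 * π * t ^ 2 : ℝ) * Complex.I) := by
      push_cast
      rw [show (2 * π * Complex.I * t ^ 2 : ℂ) = 2 * π * t ^ 2 * Complex.I by ring]
      ring
    rw [e1]
    simp only [RCLike.im_to_complex, Complex.re_ofReal_mul, Complex.im_ofReal_mul, Complex.exp_ofReal_mul_I_im, smul_eq_mul]
    ring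
  rw [setIntegral_congr_fun measurableSet_Ioi h1, integral_const_mul, integral_im hi]
  have := congrArg Complex.re hJ
  have r : ((-1 / (4 * π) + (1 - Complex.I) / (16 * π) - (1 / 16) * (1 + Complex.I / π) * (Complex.I - 1) : ℂ)) =
    (((π - 2) / (16 * π) : ℝ) : ℂ) + ((-1 / 16 : ℝ) : ℂ) * Complex.I := by
    have hpi : (π : ℂ) ≠ 0 := by exact_mod_cast pi_ne_zero
    push_cast
    field_simp
    ring_nf
    simp only [Complex.I_sq]
    ring
  rw [r, Complex.add_re, Complex.ofReal_re, Complex.re_ofReal_mul, Complex.I_re, mul_zero, add_zero] at this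
  rw [← this]
  simp
end
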